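/- The number of bicolored labelled trees rooted at a white vertex, with n_0 white and n_1 black vertices (every edge joining a white and a black vertex), having exactly k(0,c) white vertices with c children and k(1,c) black vertices with c children for all c ≥ 0 (where n_i = Σ_c k(i,c)), equals (n_0 + n_1)! · (n_0 - 1)! · n_1! / (∏_{i,c} k(i,c)! · ∏_c (c!)^{k(0,c)+k(1,c)}). -/

import Mathlib

inductive BReach {V : Type*} (f : V → V) (r : V) : V → Prop
  | base : BReach f r r
  | step (v : V) : BReach f r (f v) → BReach f r v

structure PT {V : Type*} [DecidableEq V] (S : Finset V) (col : V → Bool) (d : V → ℕ)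
    (p : (V → V) × V) : Prop where
  mem : p.2 ∈ S
  fix : p.1 p.2 = p.2
  out : ∀ v, v ∉ S → p.1 v = v
  reach : ∀ v ∈ S, BReach p.1 p.2 v
  colr : col p.2 = false
  coladj : ∀ v ∈ S, v ≠ p.2 → col (p.1 v) ≠ col v
  deg : ∀ v ∈ S, (S.filter (fun w => w ≠ p.2 ∧ p.1 w = v)).card = d v

lemma BReach.not_out {V : Type*} {f : V → V} {r v : V} (h : BReach f r v) (hv : f v = v) :
    v = r := by
  induction h with
  | base => rfl
  | step v h ih => rw [hv] at ih; exact ih hv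

lemma PT.maps {V : Type*} [DecidableEq V] {S : Finset V} {col : V → Bool} {d : V → ℕ}
    {p : (V → V) × V} (h : PT S col d p) {v : V} (hv : v ∈ S) : p.1 v ∈ S := by
  by_contra hc
  have h1 := h.out _ hc
  have h2 := h.reach v hv
  have h3 : BReach p.1 p.2 (p.1 v) := by
    generalize hr : p.2 = r at *
    cases h2 with
    | base => rw [← hr, h.fix]; exact .base
    | step _ h => exact h
  exact hc ((h3.not_out h1) ▸ h.mem)

lemma PT.fwd {V : Type*} [DecidableEq V] {S : Finset V} {col : V → Bool} {d : V → ℕ}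
    {p : (V → V) × V} {l b : V} (hl : l ∈ S) (hdl : d l = 0) (hbl : b ≠ l)
    (h : PT S col d p) (hb : p.1 l = b) :
    PT (S.erase l) col (Function.update d b (d b - 1)) (Function.update p.1 l l, p.2) := by
  obtain ⟨f, r⟩ := p
  have hm := fun v hv => h.maps (v := v) hv
  obtain ⟨mem, fix, out, reach, colr, coladj, deg⟩ := h
  dsimp only at *
  have hrl : r ≠ l := by rintro rfl; exact hbl (hb ▸ fix)
  have hno : ∀ w ∈ S, w ≠ r → f w ≠ l := by
    intro w hw hwr hfw
    have := deg l hl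
    rw [hdl, Finset.card_eq_zero] at this
    have h2 : w ∈ S.filter (fun w => w ≠ r ∧ f w = l) := by simp [hw, hwr, hfw]
    rw [this] at h2; simp at h2
  refine ⟨by simp [*], by simp [Function.update_of_ne hrl, fix], ?_, ?_, colr, ?_, ?_⟩
  · intro v hv
    dsimp only
    by_cases hvl : v = l
    · subst hvl; simp
    · rw [Function.update_of_ne hvl]
      exact out v (by simpa [hvl] using hv)
  · intro v hv
    dsimp only
    have hv1 := Finset.mem_of_mem_erase hv
    have hv2 := Finset.ne_of_mem_erase hv
    clear hv
    have := reach v hv1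
    induction this with
    | base => exact .base
    | step v h ih =>
      by_cases hvr : v = r
      · subst hvr; exact .base
      · apply BReach.step
        rw [Function.update_of_ne hv2]
        exact ih (hm v hv1) (hno v hv1 hvr)
  · intro v hv hvr
    have hv1 := Finset.mem_of_mem_erase hv
    have hv2 := Finset.ne_of_mem_erase hv
    dsimp only
    rw [Function.update_of_ne hv2]
    exact coladj v hv1 hvr
  · intro v hv
    have hv1 := Finset.mem_of_mem_erase hv
    have hv2 := Finset.ne_of_mem_erase hv
    have e : (S.erase l).filter (fun w => w ≠ r ∧ Function.update f l l w = v)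
        = (S.filter (fun w => w ≠ r ∧ f w = v)).erase l := by
      ext w
      by_cases hw : w = l
      · subst hw; simp
      · simp [hw]
    dsimp only
    rw [e]
    by_cases hvb : v = b
    · subst hvb
      rw [Finset.card_erase_of_mem (by simp [hl, hb, hrl.symm]), deg _ hv1]; simp
    · rw [Finset.erase_eq_of_notMem (by simp [hb, Ne.symm hvb]), deg _ hv1,
        Function.update_of_ne hvb]

lemma PT.bwd {V : Type*} [DecidableEq V] {S : Finset V} {col : V → Bool} {d : V → ℕ}
    {p : (V → V) × V} {l b : V} (hl : l ∈ S) (hdl : d l = 0) (hbl : b ≠ l) (hbS : b ∈ S)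
    (hc : col b ≠ col l) (hdb : 0 < d b)
    (h : PT (S.erase l) col (Function.update d b (d b - 1)) p) :
    PT S col d (Function.update p.1 l b, p.2) := by
  obtain ⟨f, r⟩ := p
  have hm := fun v hv => h.maps (v := v) hv
  obtain ⟨mem, fix, out, reach, colr, coladj, deg⟩ := h
  dsimp only at *
  have hrl : r ≠ l := Finset.ne_of_mem_erase mem
  have hre : ∀ v ∈ S.erase l, BReach (Function.update f l b) r v := by
    intro v hv
    have := reach v hv
    induction this with
    | base => exact .base
    | step v h ih =>
      apply BReach.step
      rw [Function.update_of_ne (Finset.ne_of_mem_erase hv)]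
      exact ih (hm v hv)
  refine ⟨Finset.mem_of_mem_erase mem, by simp [Function.update_of_ne hrl, fix], ?_, ?_, colr, ?_, ?_⟩
  · intro v hv
    have hvl : v ≠ l := by rintro rfl; exact hv hl
    dsimp only
    rw [Function.update_of_ne hvl]
    exact out v (by simp [hv])
  · intro v hv
    dsimp only
    by_cases hvl : v = l
    · subst hvl
      apply BReach.step
      simp only [Function.update_self]
      exact hre b (by simp [*])
    · exact hre v (by simp [*])
  · intro v hv hvr
    dsimp only
    by_cases hvl : v = l
    · subst hvl; simpa using hc
    · rw [Function.update_of_ne hvl]; exact coladj v (by simp [*]) hvr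
  · intro v hv
    dsimp only
    have e : (S.filter (fun w => w ≠ r ∧ Function.update f l b w = v)).erase l
        = (S.erase l).filter (fun w => w ≠ r ∧ f w = v) := by
      ext w
      by_cases hw : w = l
      · subst hw; simp
      · simp [hw]
    by_cases hvl : v = l
    · subst hvl
      rw [hdl, Finset.card_eq_zero, Finset.filter_eq_empty_iff]
      rintro w hw ⟨h1, h2⟩
      by_cases hwl : w = v
      · subst hwl; simp at h2; exact hbl h2
      · rw [Function.update_of_ne hwl] at h2
        have := hm w (by simp [*])
        simp [h2] at this
    · have hd := deg v (by simp [*])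
      rw [← e] at hd
      by_cases hvb : v = b
      · subst hvb
        rw [Finset.card_erase_of_mem (by simp [hl, hrl.symm])] at hd
        have : 0 < (S.filter (fun w => w ≠ r ∧ Function.update f l v w = v)).card :=
          Finset.card_pos.2 ⟨l, by simp [hl, hrl.symm]⟩
        rw [Function.update_self] at hd
        omega
      · rw [Finset.erase_eq_of_notMem (by simp [Ne.symm hvb]), Function.update_of_ne hvb] at hd
        exact hd

open Classical in
lemma PT.card_fiber {V : Type*} [Fintype V] [DecidableEq V] {S : Finset V} {col : V → Bool} {d : V → ℕ}
    {l b : V} (hl : l ∈ S) (hdl : d l = 0) (hbl : b ≠ l) (hbS : b ∈ S)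
    (hc : col b ≠ col l) (hdb : 0 < d b) :
    ((Finset.univ.filter (PT S col d)).filter (fun p => p.1 l = b)).card =
    (Finset.univ.filter (PT (S.erase l) col (Function.update d b (d b - 1)))).card := by
  refine Finset.card_bij' (fun p _ => (Function.update p.1 l l, p.2))
    (fun p _ => (Function.update p.1 l b, p.2)) ?_ ?_ ?_ ?_
  · intro p hp
    simp only [Finset.mem_filter, Finset.mem_univ, true_and] at hp ⊢
    exact hp.1.fwd hl hdl hbl hp.2
  · intro p hp
    simp only [Finset.mem_filter, Finset.mem_univ, true_and] at hp ⊢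
    exact ⟨hp.bwd hl hdl hbl hbS hc hdb, by simp⟩
  · intro p hp
    simp only [Finset.mem_filter, Finset.mem_univ, true_and] at hp ⊢
    simp [← hp.2]
  · intro p hp
    simp only [Finset.mem_filter, Finset.mem_univ, true_and] at hp ⊢
    have := hp.out l (by simp)
    ext1
    · funext x
      by_cases hx : x = l
      · subst hx; simp [this]
      · simp [hx]
    · simp

open Classical in
lemma PT.count {V : Type*} [Fintype V] [DecidableEq V] (col : V → Bool) (n : ℕ) :
    ∀ (S : Finset V) (d : V → ℕ), S.card = n + 1 →
    (∑ v ∈ S.filter (fun v => col v = false), d v = (S.filter (fun v => col v = true)).card) →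
    (∑ v ∈ S.filter (fun v => col v = true), d v + 1 = (S.filter (fun v => col v = false)).card) →
    (Finset.univ.filter (PT S col d)).card * ∏ v ∈ S, (d v).factorial =
    ((S.filter (fun v => col v = false)).card - 1).factorial *
      ((S.filter (fun v => col v = true)).card).factorial := by
  induction n with
  | zero =>
    intro S d hS hw hb
    obtain ⟨a, rfl⟩ := Finset.card_eq_one.1 hS
    have hca : col a = false := by
      by_contra hc
      simp [Finset.filter_singleton, hc] at hb
    simp [Finset.filter_singleton, hca] at hw hb
    have : Finset.univ.filter (PT {a} col d) = {(id, a)} := by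
      ext ⟨f, r⟩
      simp only [Finset.mem_filter, Finset.mem_univ, true_and, Finset.mem_singleton]
      constructor
      · intro h
        have h1 := h.mem
        have h2 := h.fix
        have h3 := h.out
        simp at h1 h2 h3
        subst h1
        ext1
        · funext x
          by_cases hx : x = r
          · subst hx; exact h2
          · exact h3 x hx
        · rfl
      · intro h
        obtain ⟨rfl, rfl⟩ := Prod.mk.inj h
        refine ⟨by simp, rfl, by simp, ?_, hca, ?_, ?_⟩
        · intro v hv
          simp at hv; subst hv; exact .base
        · intro v hv h; simp at hv; exact absurd hv h
        · intro v hv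
          simp at hv; subst hv
          rw [hw, Finset.card_eq_zero]
          ext w; simp
    simp [this, hw, Finset.filter_singleton, hca]
  | succ n ih =>
    intro S d hS hw hb
    have hsplit : ∀ T : Finset V, (T.filter (fun v => col v = false)).card
        + (T.filter (fun v => col v = true)).card = T.card := by
      intro T
      have := Finset.card_filter_add_card_filter_not (s := T) (fun v => col v = false)
      simpa using this
    have hcS := hsplit S
    have hsumS : ∑ v ∈ S.filter (fun v => col v = false), d v +
        ∑ v ∈ S.filter (fun v => col v = true), d v = ∑ v ∈ S, d v := by
      have := Finset.sum_filter_add_sum_filter_not S (fun v => col v = false) d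
      simpa using this
    obtain ⟨l, hl, hdl⟩ : ∃ l ∈ S, d l = 0 := by
      by_contra! hc
      have : ∑ v ∈ S, 1 ≤ ∑ v ∈ S, d v :=
        Finset.sum_le_sum (fun v hv => Nat.one_le_iff_ne_zero.2 (hc v hv))
      simp at this
      omega
    have hcE : (S.erase l).card = n + 1 := by rw [Finset.card_erase_of_mem hl]; omega
    set T := S.filter (fun v => col v = !col l) with hT
    have hlT : l ∉ T := by simp [hT]
    -- fiberwise
    have hmaps : Set.MapsTo (fun p : (V → V) × V => p.1 l)
        (Finset.univ.filter (PT S col d) : Finset _) (T : Finset V) := by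
      intro p hp
      simp only [Finset.coe_filter, Finset.mem_univ, true_and, Set.mem_ofPred_eq] at hp
      have hlr : l ≠ p.2 := by
        intro hlr
        -- root is a leaf, so S is a singleton
        have hno : ∀ v ∈ S, v = p.2 := by
          intro v hv
          have h1 := hp.reach v hv
          have h2 := hp.deg l hl
          rw [hdl, Finset.card_eq_zero, Finset.filter_eq_empty_iff] at h2
          have hm := fun v hv => hp.maps (v := v) hv
          induction h1 with
          | base => rfl
          | step v h ih =>
            by_contra hne
            exact h2 hv ⟨hne, (ih (hm v hv)).trans hlr.symm⟩
        have : S.card ≤ 1 := Finset.card_le_one.2 (fun a ha b hb => (hno a ha).trans (hno b hb).symm)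
        omega
      have := hp.coladj l hl hlr
      simp only [hT, Finset.coe_filter, Set.mem_ofPred_eq]
      refine ⟨hp.maps hl, ?_⟩
      revert this
      cases col (p.1 l) <;> cases col l <;> simp
    rw [Finset.card_eq_sum_card_fiberwise hmaps, Finset.sum_mul]
    have hsum : ∀ K : ℕ, (∀ b ∈ T, 0 < d b →
        (Finset.univ.filter (PT (S.erase l) col (Function.update d b (d b - 1)))).card
          * ∏ v ∈ S.erase l, (Function.update d b (d b - 1) v).factorial = K) →
        ∑ b ∈ T, ((Finset.univ.filter (PT S col d)).filter (fun p => p.1 l = b)).card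
          * ∏ v ∈ S, (d v).factorial = (∑ b ∈ T, d b) * K := by
      intro K hK
      rw [Finset.sum_mul]
      refine Finset.sum_congr rfl fun b hbT => ?_
      have hbl : b ≠ l := by rintro rfl; exact hlT hbT
      have hbS : b ∈ S := (Finset.mem_filter.1 hbT).1
      have hbc : col b = !col l := (Finset.mem_filter.1 hbT).2
      rcases Nat.eq_zero_or_pos (d b) with h0 | hpos
      · rw [h0, zero_mul]
        have : ((Finset.univ.filter (PT S col d)).filter (fun p => p.1 l = b)) = ∅ := by
          rw [Finset.filter_eq_empty_iff]
          intro p hp hpl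
          have hpt := (Finset.mem_filter.1 hp).2
          have h2 := hpt.deg b hbS
          rw [h0, Finset.card_eq_zero, Finset.filter_eq_empty_iff] at h2
          refine h2 hl ⟨?_, hpl⟩
          intro hlr
          have := hpt.fix
          rw [← hlr, hpl] at this
          exact hbl this
        rw [this]; simp
      · rw [PT.card_fiber hl hdl hbl hbS (by rw [hbc]; cases col l <;> simp) hpos, ← hK b hbT hpos]
        have hbE : b ∈ S.erase l := Finset.mem_erase.2 ⟨hbl, hbS⟩
        rw [← Finset.mul_prod_erase S _ hl, hdl, ← Finset.mul_prod_erase _ _ hbE,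
          ← Finset.mul_prod_erase _ (fun v => (Function.update d b (d b - 1) v).factorial) hbE]
        have : ∏ x ∈ (S.erase l).erase b, (Function.update d b (d b - 1) x).factorial
            = ∏ x ∈ (S.erase l).erase b, (d x).factorial := by
          refine Finset.prod_congr rfl fun x hx => ?_
          rw [Function.update_of_ne (Finset.ne_of_mem_erase hx)]
        rw [this, Function.update_self, ← Nat.mul_factorial_pred (n := d b) (by omega)]
        simp only [Nat.factorial_zero]
        ring
    -- sums of updated d
    have hupd : ∀ b, ∀ U : Finset V, b ∈ U → 0 < d b →
        ∑ v ∈ U, Function.update d b (d b - 1) v + 1 = ∑ v ∈ U, d v := by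
      intro b U hb hpos
      rw [Finset.sum_update_of_mem hb, ← Finset.add_sum_erase U d hb, Finset.sdiff_singleton_eq_erase]
      omega
    have hupd' : ∀ b, ∀ U : Finset V, b ∉ U →
        ∑ v ∈ U, Function.update d b (d b - 1) v = ∑ v ∈ U, d v := by
      intro b U hb
      exact Finset.sum_congr rfl fun x hx => Function.update_of_ne (by rintro rfl; exact hb hx) _ _
    have hsame : (S.erase l).filter (fun v => col v = col l) =
        (S.filter (fun v => col v = col l)).erase l := by
      rw [Finset.filter_erase]
    have hdiff : (S.erase l).filter (fun v => col v = !col l) = T := by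
      rw [Finset.filter_erase, Finset.erase_eq_of_notMem hlT]
    have hsums : ∑ v ∈ (S.filter (fun v => col v = col l)).erase l, d v
        = ∑ v ∈ S.filter (fun v => col v = col l), d v := by
      rw [← Finset.add_sum_erase (S.filter (fun v => col v = col l)) d (a := l) (by simp [hl]), hdl]
      simp
    have hcards : ((S.filter (fun v => col v = col l)).erase l).card + 1
        = (S.filter (fun v => col v = col l)).card := Finset.card_erase_add_one (by simp [hl])
    have hbn : ∀ b ∈ T, b ∉ (S.filter (fun v => col v = col l)).erase l := by
      intro b hb
      simp [hT] at hb ⊢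
      intro _ _ h
      rw [hb.2] at h
      cases hcl : col l <;> simp [hcl] at h
    cases hcl : col l
    · -- white leaf
      simp only [hcl, Bool.not_false] at hT hsame hdiff hsums hcards hbn
      rw [← hT] at hw hb hcS ⊢
      have h2 : 2 ≤ (S.filter (fun v => col v = false)).card := by
        by_contra hlt
        have h1 : (S.filter (fun v => col v = false)).card = 1 := by omega
        obtain ⟨a, ha⟩ := Finset.card_eq_one.1 h1
        have : l ∈ S.filter (fun v => col v = false) := by simp [hl, hcl]
        rw [ha, Finset.mem_singleton] at this
        subst this
        rw [ha] at hw
        simp [hdl] at hw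
        simp [h1, ← hw] at hcS
        omega
      rw [hsum (((S.filter (fun v => col v = false)).card - 2).factorial * T.card.factorial)]
      · obtain ⟨m, hm⟩ : ∃ m, (S.filter (fun v => col v = false)).card = m + 2 := ⟨_, (Nat.sub_add_cancel h2).symm⟩
        have : ∑ b ∈ T, d b = m + 1 := by omega
        rw [hm, this]
        simp only [Nat.add_sub_cancel, show m + 2 - 1 = m + 1 by omega, Nat.factorial_succ]
        ring
      · intro b hbT hpos
        have := ih (S.erase l) (Function.update d b (d b - 1)) hcE
        rw [hsame, hdiff, hupd' _ _ (hbn b hbT), hsums] at this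
        rw [this hw]
        · congr 2; omega
        · rw [hupd _ _ hbT hpos]; omega
    · simp only [hcl, Bool.not_true] at hT hsame hdiff hsums hcards hbn
      rw [← hT] at hw hb hcS ⊢
      rw [hsum ((T.card - 1).factorial * ((S.filter (fun v => col v = true)).card - 1).factorial)]
      · rw [hw, ← Nat.mul_factorial_pred (n := (S.filter (fun v => col v = true)).card) (by omega)]
        ring
      · intro b hbT hpos
        have := ih (S.erase l) (Function.update d b (d b - 1)) hcE
        rw [hsame, hdiff, hupd' _ _ (hbn b hbT), hsums] at this
        rw [this _ hb]
        · congr 2; omega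
        · have := hupd _ _ hbT hpos; omega

def GF {V : Type*} (f : V → V) : SimpleGraph V where
  Adj v w := v ≠ w ∧ (f v = w ∨ f w = v)
  symm := ⟨fun _ _ h => ⟨h.1.symm, h.2.symm⟩⟩
  loopless := ⟨fun _ h => h.1 rfl⟩

lemma GF.connected {V : Type*} {f : V → V} {r : V} (h : ∀ v, BReach f r v) :
    (GF f).Connected := by
  have key : ∀ v, (GF f).Reachable v r := by
    intro v
    induction h v with
    | base => exact .refl _
    | step v h ih =>
      by_cases hv : f v = v
      · rwa [hv] at ih
      · exact SimpleGraph.Reachable.trans (SimpleGraph.Adj.reachable (show (GF f).Adj v (f v) from ⟨Ne.symm hv, Or.inl rfl⟩)) ih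
  have : Nonempty V := ⟨r⟩
  exact ⟨fun u v => (key u).trans (key v).symm⟩

lemma GF.isTree {V : Type*} [Fintype V] [DecidableEq V] {f : V → V} {r : V} (hr : f r = r)
    (h : ∀ v, BReach f r v) : (GF f).IsTree := by
  rw [SimpleGraph.isTree_iff_connected_and_card]
  refine ⟨GF.connected h, le_antisymm ?_ (GF.connected h).card_vert_le_card_edgeSet_add_one⟩
  have hsub : (GF f).edgeSet ⊆ ((Finset.univ.erase r).image (fun v => s(v, f v)) : Finset (Sym2 V)) := by
    intro e
    induction e with
    | _ v w =>
      intro hvw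
      obtain ⟨hne, h1 | h1⟩ : v ≠ w ∧ (f v = w ∨ f w = v) := hvw
      · simp only [Finset.coe_image, Set.mem_image]
        refine ⟨v, ?_, by rw [h1]⟩
        simp only [Finset.coe_erase, Finset.coe_univ, Set.mem_sdiff, Set.mem_univ, true_and, Set.mem_singleton_iff]
        rintro rfl; exact hne (hr.symm.trans h1)
      · simp only [Finset.coe_image, Set.mem_image]
        refine ⟨w, ?_, by rw [h1, Sym2.eq_swap]⟩
        simp only [Finset.coe_erase, Finset.coe_univ, Set.mem_sdiff, Set.mem_univ, true_and, Set.mem_singleton_iff]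
        rintro rfl; exact hne (h1.symm.trans hr)
  have h1 := Set.ncard_le_ncard hsub (Finset.finite_toSet _)
  rw [Set.ncard_coe_finset] at h1
  have h2 := Finset.card_image_le (s := Finset.univ.erase r) (f := fun v => s(v, f v))
  rw [Finset.card_erase_of_mem (Finset.mem_univ r), Finset.card_univ] at h2
  have h3 : 0 < Fintype.card V := Fintype.card_pos_iff.2 ⟨r⟩
  rw [Nat.card_coe_set_eq, Nat.card_eq_fintype_card]
  omega

lemma BReach.two {V : Type*} {f : V → V} {r v : V} (h : BReach f r v) (hv : f (f v) = v) :
    v = r ∨ f v = r := by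
  induction h with
  | base => exact Or.inl rfl
  | step v h ih => 
    rcases ih (by rw [hv]) with h | h
    · exact Or.inr h
    · exact Or.inl (hv.symm.trans h)

lemma GF.inj {V : Type*} {f g : V → V} {r : V} (hf : f r = r) (hg : g r = r)
    (h : ∀ v, BReach f r v) (he : GF f = GF g) : f = g := by
  funext v
  induction h v with
  | base => rw [hf, hg]
  | step v h' ih =>
    by_cases hv : f v = v
    · rw [(h v).not_out hv, hf, hg]
    · have hadj : (GF f).Adj v (f v) := ⟨Ne.symm hv, Or.inl rfl⟩
      rw [he] at hadj
      obtain ⟨-, h1 | h1⟩ := hadj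
      · exact h1.symm
      · rw [← ih] at h1
        rcases (h v).two h1 with h2 | h2
        · rw [h2, hf, hg]
        · rw [h2, hf] at h1
          rw [← h1, hf, hg]

lemma GF.exists_parent {V : Type*} {G : SimpleGraph V} (hG : G.IsTree) (r : V) :
    ∃ f : V → V, f r = r ∧ (∀ v, BReach f r v) ∧ GF f = G ∧
      ∀ v, v ≠ r → G.dist r (f v) + 1 = G.dist r v := by
  classical
  have hex : ∀ v, ∃ w, v ≠ r → G.Adj v w ∧ G.dist r w + 1 = G.dist r v := by
    intro v
    by_cases hv : v = r
    · exact ⟨v, fun h => absurd hv h⟩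
    obtain ⟨p, hp⟩ := hG.connected.exists_walk_length_eq_dist v r
    cases p with
    | nil => exact absurd rfl hv
    | @cons _ w _ hadj q =>
      refine ⟨w, fun _ => ⟨hadj, ?_⟩⟩
      rw [SimpleGraph.Walk.length_cons] at hp
      have h1 := SimpleGraph.dist_le q
      have h2 := hG.connected.dist_triangle (u := v) (v := w) (w := r)
      rw [SimpleGraph.dist_eq_one_iff_adj.2 hadj] at h2
      rw [SimpleGraph.dist_comm (u := r), SimpleGraph.dist_comm (u := r)]
      omega
  choose f₀ hf₀ using hex
  let f := Function.update f₀ r r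
  have hfr : f r = r := by simp [f]
  have hf : ∀ v, v ≠ r → G.Adj v (f v) ∧ G.dist r (f v) + 1 = G.dist r v := by
    intro v hv
    have : f v = f₀ v := by simp [f, hv]
    rw [this]; exact hf₀ v hv
  have hre : ∀ n v, G.dist r v = n → BReach f r v := by
    intro n
    induction n with
    | zero =>
      intro v hv
      rw [(hG.connected.dist_eq_zero_iff).1 hv]; exact .base
    | succ n ih =>
      intro v hv
      have hne : v ≠ r := by rintro rfl; simp at hv
      exact .step v (ih _ (by have := (hf v hne).2; omega))
  refine ⟨f, hfr, fun v => hre _ v rfl, ?_, fun v hv => (hf v hv).2⟩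
  have hle : GF f ≤ G := by
    intro v w hvw
    obtain ⟨hne, h1 | h1⟩ : v ≠ w ∧ (f v = w ∨ f w = v) := hvw
    · have : v ≠ r := by rintro rfl; exact hne (hfr.symm.trans h1)
      rw [← h1]; exact (hf v this).1
    · have : w ≠ r := by rintro rfl; exact hne (h1.symm.trans hfr)
      rw [← h1]; exact (hf w this).1.symm
  exact le_antisymm hle ((SimpleGraph.isTree_iff_minimal_connected.1 hG).2 (GF.connected (fun v => hre _ v rfl)) hle)

lemma GF.children {V : Type*} [Fintype V] [DecidableEq V] {f : V → V} {r : V} (hr : f r = r)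
    (h : ∀ v, BReach f r v) (v : V) :
    {w | (GF f).Adj v w ∧ (GF f).dist r w = (GF f).dist r v + 1}.ncard =
    (Finset.univ.filter (fun w => w ≠ r ∧ f w = v)).card := by
  obtain ⟨g, hg, hgr, hgf, hd⟩ := GF.exists_parent (GF.isTree hr h) r
  have := GF.inj hg hr hgr hgf
  subst this
  rw [← Set.ncard_coe_finset]
  congr 1
  ext w
  simp only [Finset.coe_filter, Finset.mem_univ, true_and, Set.mem_ofPred_eq]
  constructor
  · rintro ⟨⟨hne, h1 | h1⟩, h2⟩
    · exfalso
      have : v ≠ r := by rintro rfl; exact hne (hr.symm.trans h1)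
      have := hd v this
      rw [h1] at this; omega
    · exact ⟨by rintro rfl; exact hne (h1.symm.trans hr), h1⟩
  · rintro ⟨h1, h2⟩
    refine ⟨⟨?_, Or.inr h2⟩, ?_⟩
    · rintro rfl; exact h1 ((h _).not_out h2)
    · rw [← hd w h1, h2]

lemma card_funs {V ι : Type*} [Fintype V] [DecidableEq V] [Fintype ι] [DecidableEq ι]
    (k : ι → ℕ) (hk : ∑ i, k i = Fintype.card V) :
    (Finset.univ.filter (fun e : V → ι => ∀ i, Fintype.card {v // e v = i} = k i)).card
      * ∏ i, (k i).factorial = (Fintype.card V).factorial := by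
  classical
  set E := Finset.univ.filter (fun e : V → ι => ∀ i, Fintype.card {v // e v = i} = k i) with hE
  have hm : ∀ e ∈ E, ∀ i, Fintype.card {v // e v = i} = k i := fun e he => (Finset.mem_filter.1 he).2
  obtain ⟨φ⟩ : Nonempty (V ≃ Σ i, Fin (k i)) := by
    rw [← Fintype.card_eq]; simp [hk]
  let e₀ : V → ι := fun v => (φ v).1
  have he₀ : e₀ ∈ E := by
    rw [hE, Finset.mem_filter]
    refine ⟨Finset.mem_univ _, fun i => ?_⟩
    rw [Fintype.card_congr ((φ.subtypeEquiv (q := fun x => x.1 = i) (fun v => Iff.rfl)).trans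
      (Equiv.sigmaSubtype i))]
    simp
  have hmaps : Set.MapsTo (fun σ : Equiv.Perm V => e₀ ∘ σ)
      (Finset.univ : Finset (Equiv.Perm V)) (E : Finset (V → ι)) := by
    intro σ _
    rw [Finset.mem_coe, hE, Finset.mem_filter]
    refine ⟨Finset.mem_univ _, fun i => ?_⟩
    rw [← hm e₀ he₀ i]
    exact Fintype.card_congr (σ.subtypeEquiv (fun v => Iff.rfl))
  have hc := Finset.card_eq_sum_card_fiberwise hmaps
  rw [Finset.card_univ, Fintype.card_perm] at hc
  rw [hc, ← smul_eq_mul, ← Finset.sum_const]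
  refine Finset.sum_congr rfl fun e he => ?_
  have : ∀ i, Nonempty ({v // e v = i} ≃ {v // e₀ v = i}) := fun i => by
    rw [← Fintype.card_eq, hm e he, hm e₀ he₀]
  let ψ := fun i => (this i).some
  let τ : Equiv.Perm V := (Equiv.sigmaFiberEquiv e).symm.trans
    ((Equiv.sigmaCongrRight ψ).trans (Equiv.sigmaFiberEquiv e₀))
  have hτ : e₀ ∘ τ = e := by
    funext v
    exact (ψ (e v) ⟨v, rfl⟩).2
  have hs := DomMulAct.stabilizer_card e₀
  simp only [hm e₀ he₀] at hs
  rw [← hs, Fintype.card_subtype]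
  refine Finset.card_bij' (fun σ _ => σ * τ) (fun σ _ => σ * τ⁻¹) ?_ ?_ ?_ ?_
  · intro σ hσ
    simp only [Finset.mem_filter, Finset.mem_univ, true_and] at hσ ⊢
    rw [Equiv.Perm.coe_mul, ← Function.comp_assoc, hσ, hτ]
  · intro σ hσ
    simp only [Finset.mem_filter, Finset.mem_univ, true_and] at hσ ⊢
    rw [Equiv.Perm.coe_mul, ← Function.comp_assoc, hσ, ← hτ]
    funext v; simp
  · intro σ _; simp
  · intro σ _; simp

lemma prod_fiber_pow {V ι M : Type*} [Fintype V] [Fintype ι] [DecidableEq ι] [CommMonoid M]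
    {k : ι → ℕ} {e : V → ι} (he : ∀ i, Fintype.card {v // e v = i} = k i) (F : ι → M) :
    ∏ v, F (e v) = ∏ i, F i ^ k i := by
  rw [← Finset.prod_fiberwise' (s := Finset.univ) e F]
  refine Finset.prod_congr rfl fun i _ => ?_
  rw [Finset.prod_const, ← he i, Fintype.card_subtype]

lemma sum_fiber_mul {V ι : Type*} [Fintype V] [Fintype ι] [DecidableEq ι]
    {k : ι → ℕ} {e : V → ι} (he : ∀ i, Fintype.card {v // e v = i} = k i) (F : ι → ℕ) :
    ∑ v, F (e v) = ∑ i, k i * F i := by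
  rw [← Finset.sum_fiberwise' (s := Finset.univ) e F]
  refine Finset.sum_congr rfl fun i _ => ?_
  rw [Finset.sum_const, ← he i, Fintype.card_subtype, smul_eq_mul]

/-- The number of bicolored labelled trees on `n₀ + n₁` vertices,
rooted at a white vertex, with `n₀` white and `n₁` black vertices (adjacent vertices
having different colors), having exactly `k₀ c` white and `k₁ c` black vertices with
`c` children for each `c`, equals
`(n₀+n₁)! (n₀-1)! n₁! / (∏ k₀ c ! k₁ c ! · ∏ (c!)^(k₀ c + k₁ c))`, stated here with
denominators cleared.  White is encoded as `false`; the children of `v` are its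
neighbours farther from the root. -/
theorem bicolored_cayley_in_types
    (n₀ n₁ : ℕ) (h0 : 0 < n₀) (k₀ k₁ : ℕ → ℕ)
    (hk₀ : ∑ c ∈ Finset.range (n₀ + n₁), k₀ c = n₀)
    (hk₁ : ∑ c ∈ Finset.range (n₀ + n₁), k₁ c = n₁)
    (hz : ∀ c, n₀ + n₁ ≤ c → k₀ c = 0 ∧ k₁ c = 0)
    (hcompat₀ : ∑ c ∈ Finset.range (n₀ + n₁), c * k₀ c = n₁)
    (hcompat₁ : ∑ c ∈ Finset.range (n₀ + n₁), c * k₁ c = n₀ - 1) :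
    {p : SimpleGraph (Fin (n₀ + n₁)) × Fin (n₀ + n₁) × (Fin (n₀ + n₁) → Bool) |
        p.1.IsTree ∧ p.2.2 p.2.1 = false ∧
        (∀ v w, p.1.Adj v w → p.2.2 v ≠ p.2.2 w) ∧
        {v | p.2.2 v = false}.ncard = n₀ ∧
        {v | p.2.2 v = true}.ncard = n₁ ∧
        (∀ c : ℕ, {v | p.2.2 v = false ∧
            {w | p.1.Adj v w ∧ p.1.dist p.2.1 w = p.1.dist p.2.1 v + 1}.ncard = c}.ncard
          = k₀ c) ∧
        (∀ c : ℕ, {v | p.2.2 v = true ∧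
            {w | p.1.Adj v w ∧ p.1.dist p.2.1 w = p.1.dist p.2.1 v + 1}.ncard = c}.ncard
          = k₁ c)}.ncard
      * ((∏ c ∈ Finset.range (n₀ + n₁), (k₀ c).factorial * (k₁ c).factorial) *
          ∏ c ∈ Finset.range (n₀ + n₁), (c.factorial) ^ (k₀ c + k₁ c)) =
    (n₀ + n₁).factorial * (n₀ - 1).factorial * n₁.factorial := by
  classical
  set N := n₀ + n₁ with hN
  have hNpos : 0 < N := by omega
  let kk : Bool × Fin N → ℕ := fun i => if i.1 then k₁ i.2 else k₀ i.2
  have hkk : ∑ i, kk i = Fintype.card (Fin N) := by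
    rw [Fintype.sum_prod_type, Fintype.card_fin, Fintype.sum_bool]
    simp only [kk, if_true, Bool.false_eq_true, if_false]
    rw [Fin.sum_univ_eq_sum_range, Fin.sum_univ_eq_sum_range, hk₀, hk₁]; omega
  have hE := card_funs (V := Fin N) kk hkk
  set E := Finset.univ.filter
    (fun e : Fin N → Bool × Fin N => ∀ i, Fintype.card {v // e v = i} = kk i) with hEdef
  have hEm : ∀ e ∈ E, ∀ i, Fintype.card {v // e v = i} = kk i :=
    fun e he => (Finset.mem_filter.1 he).2
  -- consequences of membership in E
  have hcw : ∀ e ∈ E, (Finset.univ.filter (fun v => (e v).1 = false)).card = n₀ := by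
    intro e he
    have := sum_fiber_mul (hEm e he) (fun i => if i.1 = false then 1 else 0)
    rw [Finset.card_filter, this, Fintype.sum_prod_type, Fintype.sum_bool]
    simp only [kk]
    simp
    rw [Fin.sum_univ_eq_sum_range, hk₀]
  have hcb : ∀ e ∈ E, (Finset.univ.filter (fun v => (e v).1 = true)).card = n₁ := by
    intro e he
    have := sum_fiber_mul (hEm e he) (fun i => if i.1 = true then 1 else 0)
    rw [Finset.card_filter, this, Fintype.sum_prod_type, Fintype.sum_bool]
    simp only [kk]
    simp
    rw [Fin.sum_univ_eq_sum_range, hk₁]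
  have hsw : ∀ e ∈ E, ∑ v ∈ Finset.univ.filter (fun v => (e v).1 = false), ((e v).2 : ℕ) = n₁ := by
    intro e he
    have := sum_fiber_mul (hEm e he) (fun i => if i.1 = false then (i.2 : ℕ) else 0)
    rw [Finset.sum_filter, this, Fintype.sum_prod_type, Fintype.sum_bool]
    simp only [kk]
    simp
    rw [Fin.sum_univ_eq_sum_range (fun c => k₀ c * c), ← hcompat₀]
    exact Finset.sum_congr rfl fun _ _ => mul_comm _ _
  have hsb : ∀ e ∈ E, ∑ v ∈ Finset.univ.filter (fun v => (e v).1 = true), ((e v).2 : ℕ) = n₀ - 1 := by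
    intro e he
    have := sum_fiber_mul (hEm e he) (fun i => if i.1 = true then (i.2 : ℕ) else 0)
    rw [Finset.sum_filter, this, Fintype.sum_prod_type, Fintype.sum_bool]
    simp only [kk]
    simp
    rw [Fin.sum_univ_eq_sum_range (fun c => k₁ c * c), ← hcompat₁]
    exact Finset.sum_congr rfl fun _ _ => mul_comm _ _
  have hprod : ∀ e ∈ E, ∏ v, ((e v).2 : ℕ).factorial
      = ∏ c ∈ Finset.range N, (c.factorial) ^ (k₀ c + k₁ c) := by
    intro e he
    rw [prod_fiber_pow (hEm e he) (fun i => (i.2 : ℕ).factorial), Fintype.prod_prod_type,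
      Fintype.prod_bool]
    simp only [kk, if_true, Bool.false_eq_true, if_false]
    rw [← Finset.prod_mul_distrib, Fin.prod_univ_eq_prod_range
      (fun c => c.factorial ^ k₁ c * c.factorial ^ k₀ c)]
    exact Finset.prod_congr rfl fun c _ => by rw [pow_add, mul_comm]
  have hkprod : ∏ i, (kk i).factorial
      = ∏ c ∈ Finset.range N, (k₀ c).factorial * (k₁ c).factorial := by
    rw [Fintype.prod_prod_type, Fintype.prod_bool]
    simp only [kk, if_true, Bool.false_eq_true, if_false]
    rw [← Finset.prod_mul_distrib, Fin.prod_univ_eq_prod_range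
      (fun c => (k₁ c).factorial * (k₀ c).factorial)]
    exact Finset.prod_congr rfl fun c _ => mul_comm _ _
  let ch : SimpleGraph (Fin N) → Fin N → Fin N → ℕ := fun G r v =>
    {w | G.Adj v w ∧ G.dist r w = G.dist r v + 1}.ncard
  have hch : ∀ G r v, ch G r v < N := by
    intro G r v
    have h1 : {w | G.Adj v w ∧ G.dist r w = G.dist r v + 1} ⊂ (Set.univ : Set (Fin N)) := by
      rw [Set.ssubset_univ_iff]
      intro h
      have : v ∈ {w | G.Adj v w ∧ G.dist r w = G.dist r v + 1} := h ▸ Set.mem_univ v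
      exact G.loopless.irrefl _ this.1
    have := Set.ncard_lt_ncard h1
    simpa using this
  let M : Finset (SimpleGraph (Fin N) × Fin N × (Fin N → Bool)) := Finset.univ.filter fun p =>
    p.1.IsTree ∧ p.2.2 p.2.1 = false ∧ (∀ v w, p.1.Adj v w → p.2.2 v ≠ p.2.2 w) ∧
      (fun v => (p.2.2 v, (⟨ch p.1 p.2.1 v, hch _ _ _⟩ : Fin N))) ∈ E
  have hMset : ∀ (G : SimpleGraph (Fin N)) (r : Fin N) (col : Fin N → Bool),
      ((fun v => (col v, (⟨ch G r v, hch _ _ _⟩ : Fin N))) ∈ E) ↔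
      ({v | col v = false}.ncard = n₀ ∧ {v | col v = true}.ncard = n₁ ∧
        (∀ c : ℕ, {v | col v = false ∧ ch G r v = c}.ncard = k₀ c) ∧
        (∀ c : ℕ, {v | col v = true ∧ ch G r v = c}.ncard = k₁ c)) := by
    intro G r col
    have hconv : ∀ (b : Bool) (c : Fin N), Fintype.card
        {v // (col v, (⟨ch G r v, hch _ _ _⟩ : Fin N)) = (b, c)}
        = {v | col v = b ∧ ch G r v = c}.ncard := by
      intro b c
      rw [Fintype.card_subtype, ← Set.ncard_coe_finset]
      congr 1
      ext v
      simp [Prod.ext_iff, Fin.ext_iff]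
    have hbig : ∀ (b : Bool) (c : ℕ), N ≤ c → {v | col v = b ∧ ch G r v = c}.ncard = 0 := by
      intro b c hc
      rw [Set.ncard_eq_zero]
      ext v
      have := hch G r v
      simp only [Set.mem_ofPred_eq, Set.mem_empty_iff_false, iff_false]
      omega
    constructor
    · intro he
      have h1 := hEm _ he
      have h2 := hcw _ he
      have h3 := hcb _ he
      refine ⟨?_, ?_, ?_, ?_⟩
      · rw [← h2, ← Set.ncard_coe_finset]; simp
      · rw [← h3, ← Set.ncard_coe_finset]; simp
      · intro c
        by_cases hc : c < N
        · have := h1 (false, ⟨c, hc⟩)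
          rw [hconv] at this
          simpa [kk] using this
        · rw [hbig _ _ (not_lt.1 hc), (hz c (not_lt.1 hc)).1]
      · intro c
        by_cases hc : c < N
        · have := h1 (true, ⟨c, hc⟩)
          rw [hconv] at this
          simpa [kk] using this
        · rw [hbig _ _ (not_lt.1 hc), (hz c (not_lt.1 hc)).2]
    · rintro ⟨-, -, h1, h2⟩
      rw [hEdef, Finset.mem_filter]
      refine ⟨Finset.mem_univ _, ?_⟩
      rintro ⟨b, c⟩
      rw [hconv]
      cases b
      · rw [h1]; simp [kk]
      · rw [h2]; simp [kk]
  have hMcard : ∀ X : Set (SimpleGraph (Fin N) × Fin N × (Fin N → Bool)),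
      X = (M : Set _) → X.ncard = M.card := by
    rintro X rfl; exact Set.ncard_coe_finset _
  rw [hMcard _ (by
    ext ⟨G, r, col⟩
    simp only [M, Finset.coe_filter, Finset.mem_univ, true_and, Set.mem_ofPred_eq]
    rw [hMset])]
  have hmaps : Set.MapsTo (fun p : SimpleGraph (Fin N) × Fin N × (Fin N → Bool) =>
      (fun v => (p.2.2 v, (⟨ch p.1 p.2.1 v, hch _ _ _⟩ : Fin N)))) (M : Set _) (E : Set _) := by
    intro p hp
    exact (Finset.mem_filter.1 hp).2.2.2.2
  rw [Finset.card_eq_sum_card_fiberwise hmaps, ← hkprod]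
  have hfib : ∀ e ∈ E, (M.filter (fun p => (fun v => (p.2.2 v,
      (⟨ch p.1 p.2.1 v, hch _ _ _⟩ : Fin N))) = e)).card =
      (Finset.univ.filter (PT Finset.univ (fun v => (e v).1) (fun v => ((e v).2 : ℕ)))).card := by
    intro e he
    symm
    refine Finset.card_bij (fun p _ => (GF p.1, p.2, fun v => (e v).1)) ?_ ?_ ?_
    · rintro ⟨f, r⟩ hp
      have hp := (Finset.mem_filter.1 hp).2
      have hre : ∀ v, BReach f r v := fun v => hp.reach v (Finset.mem_univ v)
      have hfe : (fun v => ((e v).1, (⟨ch (GF f) r v, hch _ _ _⟩ : Fin N))) = e := by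
        funext v
        refine Prod.ext rfl (Fin.ext ?_)
        exact (GF.children hp.fix hre v).trans (hp.deg v (Finset.mem_univ v))
      simp only [M, Finset.mem_filter, Finset.mem_univ, true_and]
      refine ⟨⟨GF.isTree hp.fix hre, hp.colr, ?_, hfe ▸ he⟩, hfe⟩
      rintro v w ⟨hne, h1 | h1⟩
      · subst h1
        refine (hp.coladj v (Finset.mem_univ v) ?_).symm
        rintro rfl
        exact hne hp.fix.symm
      · subst h1
        refine (hp.coladj w (Finset.mem_univ w) ?_)
        rintro rfl
        exact hne hp.fix
    · rintro ⟨f, r⟩ hp ⟨g, r'⟩ hp' heq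
      have hp := (Finset.mem_filter.1 hp).2
      have hp' := (Finset.mem_filter.1 hp').2
      simp only [Prod.mk.injEq, and_true] at heq
      obtain ⟨h1, rfl⟩ := heq
      have := GF.inj hp.fix hp'.fix (fun v => hp.reach v (Finset.mem_univ v)) h1
      dsimp only at this
      rw [this]
    · rintro ⟨G, r, col⟩ hp
      simp only [M, Finset.mem_filter, Finset.mem_univ, true_and] at hp
      obtain ⟨⟨hT, hcr, hca, -⟩, hfe⟩ := hp
      obtain ⟨f, hfr, hre, rfl, -⟩ := GF.exists_parent hT r
      subst hfe
      refine ⟨(f, r), ?_, rfl⟩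
      rw [Finset.mem_filter]
      refine ⟨Finset.mem_univ _, Finset.mem_univ _, hfr, by simp, fun v _ => hre v, hcr, ?_, ?_⟩
      · intro v _ hv
        refine (hca v (f v) ⟨?_, Or.inl rfl⟩).symm
        intro h
        exact hv ((hre v).not_out h.symm)
      · intro v _
        exact (GF.children hfr hre v).symm
  have hterm : ∀ e ∈ E, (M.filter (fun p => (fun v => (p.2.2 v,
      (⟨ch p.1 p.2.1 v, hch _ _ _⟩ : Fin N))) = e)).card *
      ∏ c ∈ Finset.range N, (c.factorial) ^ (k₀ c + k₁ c) =
      (n₀ - 1).factorial * n₁.factorial := by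
    intro e he
    rw [hfib e he, ← hprod e he]
    have := PT.count (fun v => (e v).1) (N - 1) Finset.univ (fun v => ((e v).2 : ℕ))
      (by simp; omega) (by rw [hsw e he, hcb e he]) (by rw [hsb e he, hcw e he]; omega)
    rw [hcw e he, hcb e he] at this
    exact this
  rw [mul_comm (∏ i, (kk i).factorial), ← mul_assoc, Finset.sum_mul, Finset.sum_congr rfl hterm,
    Finset.sum_const, smul_eq_mul, mul_right_comm, hE, Fintype.card_fin, mul_assoc]
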